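/- arXiv:2511.16558 — 3 statements merged into one kernel-verified Lean document; each statement's English description precedes it below -/
import Mathlib

section
/- The map sending a perfect matching M of G□K₂ to the pair (M₁, M₂), where M₁ = { {u,v} ∈ E : {(u,1),(v,1)} ∈ M } and M₂ = { {u,v} ∈ E : {(u,2),(v,2)} ∈ M }, is a bijection from the set of perfect matchings of G□K₂ onto the set of pairs (M₁, M₂) of matchings of G such that the set of vertices covered by M₁ equals the set of vertices covered by M₂. -/
open scoped Classical

/-- `M` is a matching of `G`: a finite set of edges of `G` that are pairwise vertex-disjoint. -/
def IsMatchingSet {α : Type*} (G : SimpleGraph α) (M : Finset (Sym2 α)) : Prop :=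
  (∀ e ∈ M, e ∈ G.edgeSet) ∧ ∀ e ∈ M, ∀ f ∈ M, e ≠ f → ∀ v, v ∈ e → v ∉ f

/-- The set of vertices covered by a set of edges `M`. -/
noncomputable def coveredBy {α : Type*} [Fintype α] (M : Finset (Sym2 α)) : Finset α :=
  Finset.univ.filter fun v => ∃ e ∈ M, v ∈ e

/-- The edges of `G` whose copy in layer `i` of `G □ K₂` belongs to `M`. -/
noncomputable def layerEdges {V : Type*} [Fintype V] (G : SimpleGraph V)
    (M : Finset (Sym2 (V × Fin 2))) (i : Fin 2) : Finset (Sym2 V) :=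
  Finset.univ.filter fun e : Sym2 V => e ∈ G.edgeSet ∧ Sym2.map (fun v => (v, i)) e ∈ M

/-- The edges of `G □ K₂` consisting of the copies of `P i` in layer `i`, together with the rungs
at the vertices that `P 0` leaves uncovered. -/
noncomputable def glueLayers {V : Type*} [Fintype V] (P : Fin 2 → Finset (Sym2 V)) :
    Finset (Sym2 (V × Fin 2)) :=
  Finset.univ.filter fun e => (∃ i, ∃ f ∈ P i, Sym2.map (fun v => (v, i)) f = e) ∨
    ∃ v, v ∉ coveredBy (P 0) ∧ s((v, 0), (v, 1)) = e

theorem isMatchingSet_iff {α : Type*} {G : SimpleGraph α} {M : Finset (Sym2 α)} :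
    IsMatchingSet G M ↔ (∀ a b, s(a, b) ∈ M → G.Adj a b) ∧
      ∀ a b c, s(a, b) ∈ M → s(a, c) ∈ M → b = c := by
  refine ⟨fun h => ⟨fun a b hab => h.1 _ hab, fun a b c hb hc => ?_⟩, fun h => ⟨?_, ?_⟩⟩
  · by_contra hne
    exact h.2 _ hb _ hc (fun heq => hne (Sym2.congr_right.1 heq)) a (Sym2.mem_mk_left a b)
      (Sym2.mem_mk_left a c)
  · intro e
    induction e with | _ a b => exact h.1 a b
  · rintro e he f hf hne v ⟨b, rfl⟩ ⟨c, rfl⟩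
    exact hne (by rw [h.2 v b c he hf])

theorem mem_coveredBy {α : Type*} [Fintype α] {M : Finset (Sym2 α)} {v : α} :
    v ∈ coveredBy M ↔ ∃ w, s(v, w) ∈ M := by
  simp only [coveredBy, Finset.mem_filter, Finset.mem_univ, true_and]
  constructor
  · rintro ⟨e, he, w, rfl⟩
    exact ⟨w, he⟩
  · rintro ⟨w, hw⟩
    exact ⟨_, hw, Sym2.mem_mk_left v w⟩

section

variable {V : Type*} [Fintype V] {G : SimpleGraph V}

theorem mem_layerEdges {M : Finset (Sym2 (V × Fin 2))} {i : Fin 2} {u v : V} :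
    s(u, v) ∈ layerEdges G M i ↔ G.Adj u v ∧ s((u, i), (v, i)) ∈ M := by
  simp [layerEdges]

theorem isMatchingSet_layerEdges {M : Finset (Sym2 (V × Fin 2))}
    (hM : IsMatchingSet (G.boxProd (⊤ : SimpleGraph (Fin 2))) M) (i : Fin 2) :
    IsMatchingSet G (layerEdges G M i) := by
  rw [isMatchingSet_iff] at hM ⊢
  simp only [mem_layerEdges]
  exact ⟨fun a b h => h.1, fun a b c hb hc => congrArg Prod.fst (hM.2 _ _ _ hb.2 hc.2)⟩

/-- In a perfect matching of `G □ K₂`, a rung is used exactly at the vertices that the edges of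
either layer leave uncovered. -/
theorem rung_mem_iff {M : Finset (Sym2 (V × Fin 2))}
    (hM : IsMatchingSet (G.boxProd (⊤ : SimpleGraph (Fin 2))) M)
    (hcov : coveredBy M = Finset.univ) {i j : Fin 2} (hij : i ≠ j) (v : V) :
    s((v, i), (v, j)) ∈ M ↔ v ∉ coveredBy (layerEdges G M i) := by
  rw [isMatchingSet_iff] at hM
  simp only [mem_coveredBy, mem_layerEdges]
  constructor
  · rintro h ⟨w, -, hw⟩
    exact hij (congrArg Prod.snd (hM.2 _ _ _ h hw)).symm
  · intro h
    obtain ⟨⟨x, k⟩, hx⟩ := mem_coveredBy.1 (hcov ▸ Finset.mem_univ (v, i))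
    have hadj := hM.1 _ _ hx
    simp only [SimpleGraph.boxProd_adj, SimpleGraph.top_adj] at hadj
    obtain ⟨ha, rfl⟩ | ⟨hk, rfl⟩ := hadj
    · exact (h ⟨x, ha, hx⟩).elim
    · obtain rfl : k = j := by omega
      exact hx

theorem coveredBy_layerEdges_eq {M : Finset (Sym2 (V × Fin 2))}
    (hM : IsMatchingSet (G.boxProd (⊤ : SimpleGraph (Fin 2))) M)
    (hcov : coveredBy M = Finset.univ) :
    coveredBy (layerEdges G M 0) = coveredBy (layerEdges G M 1) := by
  ext v
  rw [← not_iff_not, ← rung_mem_iff hM hcov zero_ne_one, ← rung_mem_iff hM hcov one_ne_zero,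
    Sym2.eq_swap]

theorem subset_of_layerEdges_eq {M N : Finset (Sym2 (V × Fin 2))}
    (hM : IsMatchingSet (G.boxProd (⊤ : SimpleGraph (Fin 2))) M)
    (hMcov : coveredBy M = Finset.univ)
    (hN : IsMatchingSet (G.boxProd (⊤ : SimpleGraph (Fin 2))) N)
    (hNcov : coveredBy N = Finset.univ)
    (h : ∀ i, layerEdges G M i = layerEdges G N i) : M ⊆ N := by
  intro e he
  induction e with | _ a b => ?_
  obtain ⟨u, i⟩ := a
  obtain ⟨v, j⟩ := b
  have hadj := hM.1 _ he
  simp only [SimpleGraph.mem_edgeSet, SimpleGraph.boxProd_adj, SimpleGraph.top_adj] at hadj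
  obtain ⟨ha, rfl⟩ | ⟨hij, rfl⟩ := hadj
  · have hmem : s(u, v) ∈ layerEdges G M i := mem_layerEdges.2 ⟨ha, he⟩
    rw [h i] at hmem
    exact (mem_layerEdges.1 hmem).2
  · rw [rung_mem_iff hM hMcov hij, h i] at he
    exact (rung_mem_iff hN hNcov hij u).2 he

theorem mem_glueLayers {P : Fin 2 → Finset (Sym2 V)} {u v : V} {i j : Fin 2} :
    s((u, i), (v, j)) ∈ glueLayers P ↔
      (i = j ∧ s(u, v) ∈ P i) ∨ (i ≠ j ∧ u = v ∧ u ∉ coveredBy (P 0)) := by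
  simp only [glueLayers, Finset.mem_filter, Finset.mem_univ, true_and]
  refine or_congr ⟨?_, ?_⟩ ⟨?_, ?_⟩
  · rintro ⟨k, f, hf, hfe⟩
    induction f with | _ a b => ?_
    simp only [Sym2.map_mk, Sym2.eq_iff, Prod.mk.injEq] at hfe
    obtain ⟨⟨rfl, rfl⟩, rfl, rfl⟩ | ⟨⟨rfl, rfl⟩, rfl, rfl⟩ := hfe
    · exact ⟨rfl, hf⟩
    · exact ⟨rfl, Sym2.eq_swap ▸ hf⟩
  · rintro ⟨rfl, h⟩
    exact ⟨i, _, h, rfl⟩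
  · rintro ⟨w, hw, hwe⟩
    simp only [Sym2.eq_iff, Prod.mk.injEq] at hwe
    obtain ⟨⟨rfl, rfl⟩, rfl, rfl⟩ | ⟨⟨rfl, rfl⟩, rfl, rfl⟩ := hwe
    · exact ⟨zero_ne_one, rfl, hw⟩
    · exact ⟨one_ne_zero, rfl, hw⟩
  · rintro ⟨hij, rfl, hu⟩
    refine ⟨u, hu, ?_⟩
    obtain ⟨rfl, rfl⟩ | ⟨rfl, rfl⟩ : (i = 0 ∧ j = 1) ∨ (i = 1 ∧ j = 0) := by omega
    · rfl
    · exact Sym2.eq_swap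

theorem isMatchingSet_glueLayers {P : Fin 2 → Finset (Sym2 V)}
    (hP : ∀ i, IsMatchingSet G (P i)) (hcov : ∀ i, coveredBy (P i) = coveredBy (P 0)) :
    IsMatchingSet (G.boxProd (⊤ : SimpleGraph (Fin 2))) (glueLayers P) := by
  simp only [isMatchingSet_iff] at hP
  refine isMatchingSet_iff.2 ⟨?_, ?_⟩
  · rintro ⟨u, i⟩ ⟨v, j⟩ h
    simp only [SimpleGraph.boxProd_adj, SimpleGraph.top_adj]
    obtain ⟨rfl, huv⟩ | ⟨hij, rfl, -⟩ := mem_glueLayers.1 h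
    · exact Or.inl ⟨(hP i).1 _ _ huv, rfl⟩
    · exact Or.inr ⟨hij, rfl⟩
  · rintro ⟨u, i⟩ ⟨v, j⟩ ⟨w, k⟩ hv hw
    rw [mem_glueLayers, ← hcov i] at hv hw
    obtain ⟨rfl, hv⟩ | ⟨hij, rfl, hv⟩ := hv <;> obtain ⟨rfl, hw⟩ | ⟨hik, rfl, hw⟩ := hw
    · rw [(hP i).2 _ _ _ hv hw]
    · exact (hw (mem_coveredBy.2 ⟨_, hv⟩)).elim
    · exact (hv (mem_coveredBy.2 ⟨_, hw⟩)).elim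
    · obtain rfl : j = k := by omega
      rfl

theorem coveredBy_glueLayers {P : Fin 2 → Finset (Sym2 V)}
    (hcov : ∀ i, coveredBy (P i) = coveredBy (P 0)) :
    coveredBy (glueLayers P) = Finset.univ := by
  refine Finset.eq_univ_iff_forall.2 fun ⟨v, i⟩ => mem_coveredBy.2 ?_
  by_cases hv : v ∈ coveredBy (P i)
  · obtain ⟨w, hw⟩ := mem_coveredBy.1 hv
    exact ⟨(w, i), mem_glueLayers.2 (Or.inl ⟨rfl, hw⟩)⟩
  · exact ⟨(v, i + 1), mem_glueLayers.2 (Or.inr ⟨by omega, rfl, hcov i ▸ hv⟩)⟩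

theorem layerEdges_glueLayers {P : Fin 2 → Finset (Sym2 V)}
    (hP : ∀ i, IsMatchingSet G (P i)) (i : Fin 2) : layerEdges G (glueLayers P) i = P i := by
  ext e
  induction e with | _ u v => ?_
  simp only [mem_layerEdges, mem_glueLayers, ne_eq, not_true_eq_false, false_and, or_false,
    true_and]
  exact and_iff_right_of_imp fun h => (hP i).1 _ h

end

/-- The map sending a perfect matching `M` of `G □ K₂` to the pair `(M₁, M₂)`, where
`M₁ = { {u,v} ∈ E : {(u,1),(v,1)} ∈ M }` and `M₂ = { {u,v} ∈ E : {(u,2),(v,2)} ∈ M }`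
(here the two copies of `G` are indexed by `0` and `1` in `Fin 2`), is a bijection from
the set of perfect matchings of `G □ K₂` onto the set of pairs `(M₁, M₂)` of matchings
of `G` such that the vertices covered by `M₁` equal the vertices covered by `M₂`. -/
theorem stmt0 {V : Type*} [Fintype V] (G : SimpleGraph V) :
    Set.BijOn
      (fun M : Finset (Sym2 (V × Fin 2)) =>
        ((Finset.univ.filter fun e : Sym2 V =>
            e ∈ G.edgeSet ∧ Sym2.map (fun v => (v, (0 : Fin 2))) e ∈ M),
         (Finset.univ.filter fun e : Sym2 V =>
            e ∈ G.edgeSet ∧ Sym2.map (fun v => (v, (1 : Fin 2))) e ∈ M)))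
      {M : Finset (Sym2 (V × Fin 2)) |
        IsMatchingSet (G.boxProd (⊤ : SimpleGraph (Fin 2))) M ∧ coveredBy M = Finset.univ}
      {p : Finset (Sym2 V) × Finset (Sym2 V) |
        IsMatchingSet G p.1 ∧ IsMatchingSet G p.2 ∧ coveredBy p.1 = coveredBy p.2} := by
  refine ⟨?_, ?_, ?_⟩
  · rintro M ⟨hM, hcov⟩
    exact ⟨isMatchingSet_layerEdges hM 0, isMatchingSet_layerEdges hM 1,
      coveredBy_layerEdges_eq hM hcov⟩
  · rintro M ⟨hM, hMcov⟩ N ⟨hN, hNcov⟩ h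
    have hlayers : ∀ i, layerEdges G M i = layerEdges G N i :=
      Fin.forall_fin_two.2 ⟨congrArg Prod.fst h, congrArg Prod.snd h⟩
    exact (subset_of_layerEdges_eq hM hMcov hN hNcov hlayers).antisymm
      (subset_of_layerEdges_eq hN hNcov hM hMcov fun i => (hlayers i).symm)
  · rintro ⟨M₁, M₂⟩ ⟨h₁, h₂, hcov⟩
    have hP : ∀ i, IsMatchingSet G (![M₁, M₂] i) := Fin.forall_fin_two.2 ⟨h₁, h₂⟩
    have hPcov : ∀ i, coveredBy (![M₁, M₂] i) = coveredBy (![M₁, M₂] 0) :=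
      Fin.forall_fin_two.2 ⟨rfl, hcov.symm⟩
    exact ⟨glueLayers ![M₁, M₂], ⟨isMatchingSet_glueLayers hP hPcov, coveredBy_glueLayers hPcov⟩,
      Prod.ext (layerEdges_glueLayers hP 0) (layerEdges_glueLayers hP 1)⟩
end

section
/- For any finite simple graph G=(V,E) and any integer k with 1 ≤ k ≤ |V|/2, the numbers of matchings by size are log-concave: m_{k-1}·m_{k+1} ≤ m_k². -/
open scoped Classical

/-- `mCount G k` is the number of matchings of `G` with exactly `k` edges. -/
noncomputable def mCount {α : Type*} [Fintype α] (G : SimpleGraph α) (k : ℕ) : ℕ :=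
  (Finset.univ.filter fun M : Finset (Sym2 α) => IsMatchingSet G M ∧ M.card = k).card

/-- The matchings of `G` with `k` edges, all of them inside `S`. The size is an integer, so that
there are none of negative size. -/
noncomputable def matchingsIn {V : Type*} [Fintype V] (G : SimpleGraph V) (S : Finset V) (k : ℤ) :
    Finset (Finset (Sym2 V)) :=
  Finset.univ.filter fun M =>
    IsMatchingSet G M ∧ (∀ e ∈ M, ∀ x ∈ e, x ∈ S) ∧ (M.card : ℤ) = k

/-- The number of matchings of `G` inside `S`, as a sequence indexed by the integers. -/
noncomputable def matchingSeq {V : Type*} [Fintype V] (G : SimpleGraph V) (S : Finset V) : ℤ → ℤ :=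
  fun k => (matchingsIn G S k).card

/-- The sequence delayed by one step. -/
def shift (f : ℤ → ℤ) : ℤ → ℤ := fun k => f (k - 1)

/-- The polarization of the log-concavity defect `2 * (f k ^ 2 - f (k - 1) * f (k + 1))`. -/
def logConcForm (k : ℤ) : (ℤ → ℤ) →ₗ[ℤ] (ℤ → ℤ) →ₗ[ℤ] ℤ :=
  LinearMap.mk₂ ℤ (fun f g => 2 * (f k * g k) - f (k - 1) * g (k + 1) - f (k + 1) * g (k - 1))
    (fun _ _ _ => by simp only [Pi.add_apply]; ring)
    (fun _ _ _ => by simp only [Pi.smul_apply, smul_eq_mul]; ring)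
    (fun _ _ _ => by simp only [Pi.add_apply]; ring)
    (fun _ _ _ => by simp only [Pi.smul_apply, smul_eq_mul]; ring)

theorem logConcForm_apply (k : ℤ) (f g : ℤ → ℤ) :
    logConcForm k f g = 2 * (f k * g k) - f (k - 1) * g (k + 1) - f (k + 1) * g (k - 1) := rfl

theorem logConcForm_comm (k : ℤ) (f g : ℤ → ℤ) : logConcForm k f g = logConcForm k g f := by
  simp only [logConcForm_apply]; ring

theorem logConcForm_shift_shift (k : ℤ) (f g : ℤ → ℤ) :
    logConcForm k (shift f) (shift g) = logConcForm (k - 1) f g := by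
  simp only [logConcForm_apply, shift, add_sub_right_comm]

/-- A log-concave nonnegative sequence without internal zeros, supported on the nonnegative
integers, satisfies `f (k - 2) * f (k + 1) ≤ f (k - 1) * f k`. -/
theorem logConcForm_self_shift_nonneg {f : ℤ → ℤ} (h0 : ∀ k, 0 ≤ f k) (hneg : ∀ k < 0, f k = 0)
    (hpos : ∀ k, 0 ≤ k → 0 < f (k + 1) → 0 < f k) (hf : ∀ k, 0 ≤ logConcForm k f f) (k : ℤ) :
    0 ≤ logConcForm k f (shift f) := by
  have h1 := hf k
  have h2 := hf (k - 1)
  simp only [logConcForm_apply, shift, sub_add_cancel, add_sub_cancel_right] at *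
  have e : k - 1 - 1 = k - 2 := by ring
  rw [e] at h2 ⊢
  rcases lt_or_ge (k - 2) 0 with hk | hk
  · rw [hneg _ hk]
    nlinarith [mul_nonneg (h0 k) (h0 (k - 1))]
  rcases (h0 (k + 1)).eq_or_lt with hz | hp
  · rw [← hz]
    nlinarith [mul_nonneg (h0 k) (h0 (k - 1))]
  have pk : 0 < f k := hpos k (by omega) hp
  have pk1 : 0 < f (k - 1) := hpos (k - 1) (by omega) (by rwa [sub_add_cancel])
  have hprod : (f (k - 2) * f k) * (f (k - 1) * f (k + 1)) ≤ (f (k - 1) * f (k - 1)) * (f k * f k) :=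
    mul_le_mul (by linarith) (by linarith) (mul_nonneg (h0 _) (h0 _)) (mul_self_nonneg _)
  have : f (k + 1) * f (k - 2) ≤ f k * f (k - 1) := by
    refine le_of_mul_le_mul_left ?_ (mul_pos pk pk1)
    linarith
  linarith

theorem IsMatchingSet.mono {V : Type*} {G : SimpleGraph V} {M N : Finset (Sym2 V)}
    (hM : IsMatchingSet G M) (h : N ⊆ M) : IsMatchingSet G N :=
  ⟨fun e he => hM.1 e (h he), fun e he f hf => hM.2 e (h he) f (h hf)⟩

section MatchingSeq

variable {V : Type*} [Fintype V] (G : SimpleGraph V)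

theorem mem_matchingsIn {S : Finset V} {k : ℤ} {M : Finset (Sym2 V)} :
    M ∈ matchingsIn G S k ↔
      IsMatchingSet G M ∧ (∀ e ∈ M, ∀ x ∈ e, x ∈ S) ∧ (M.card : ℤ) = k := by
  simp [matchingsIn]

theorem matchingSeq_nonneg (S : Finset V) (k : ℤ) : 0 ≤ matchingSeq G S k := by
  simp [matchingSeq]

theorem matchingSeq_of_neg (S : Finset V) (k : ℤ) (hk : k < 0) : matchingSeq G S k = 0 := by
  simp only [matchingSeq, Nat.cast_eq_zero, Finset.card_eq_zero]
  refine Finset.eq_empty_of_forall_notMem fun M hM => ?_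
  have := ((mem_matchingsIn G).1 hM).2.2
  omega

theorem matchingSeq_pos_of_succ (S : Finset V) (k : ℤ) (hk : 0 ≤ k)
    (h : 0 < matchingSeq G S (k + 1)) : 0 < matchingSeq G S k := by
  simp only [matchingSeq, Nat.cast_pos, Finset.card_pos] at *
  obtain ⟨M, hM⟩ := h
  obtain ⟨h1, h2, h3⟩ := (mem_matchingsIn G).1 hM
  obtain ⟨e, he⟩ : M.Nonempty := Finset.card_pos.1 (by omega)
  refine ⟨M.erase e, (mem_matchingsIn G).2 ⟨h1.mono (Finset.erase_subset _ _),
    fun f hf => h2 f (Finset.mem_of_mem_erase hf), ?_⟩⟩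
  have := Finset.card_erase_add_one he
  omega

theorem matchingSeq_empty (k : ℤ) : matchingSeq G ∅ k = if k = 0 then 1 else 0 := by
  have key : ∀ M, M ∈ matchingsIn G ∅ k ↔ M = ∅ ∧ k = 0 := by
    intro M
    rw [mem_matchingsIn]
    constructor
    · rintro ⟨-, h2, h3⟩
      have hM : M = ∅ := by
        refine Finset.eq_empty_of_forall_notMem fun e he => ?_
        induction e with
        | h x y => exact Finset.notMem_empty x (h2 _ he x (Sym2.mem_mk_left x y))
      subst hM
      exact ⟨rfl, by simpa using h3.symm⟩
    · rintro ⟨rfl, rfl⟩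
      simp [IsMatchingSet]
  unfold matchingSeq
  split_ifs with hk
  · have : matchingsIn G ∅ k = {∅} := by ext M; rw [key]; simp [hk]
    simp [this]
  · have : matchingsIn G ∅ k = ∅ := by ext M; simp [key, hk]
    simp [this]

/-- The matchings inside `S`, sorted by the edge at `v`. -/
theorem matchingsIn_eq_union {S : Finset V} {v : V} (hv : v ∈ S) (k : ℤ) :
    matchingsIn G S k = matchingsIn G (S.erase v) k ∪
      ((S.erase v).filter (G.Adj v)).biUnion fun u =>
        (matchingsIn G ((S.erase v).erase u) (k - 1)).image (insert s(v, u)) := by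
  ext M
  simp only [Finset.mem_union, Finset.mem_biUnion, Finset.mem_filter, Finset.mem_image,
    mem_matchingsIn]
  constructor
  · rintro ⟨h1, h2, h3⟩
    by_cases hc : ∃ e ∈ M, v ∈ e
    · right
      obtain ⟨e, he, hve⟩ := hc
      obtain ⟨u, rfl⟩ := Sym2.mem_iff_exists.1 hve
      have hadj : G.Adj v u := h1.1 _ he
      refine ⟨u, ⟨Finset.mem_erase.2 ⟨hadj.ne', h2 _ he u (Sym2.mem_mk_right v u)⟩, hadj⟩,
        M.erase s(v, u), ⟨h1.mono (Finset.erase_subset _ _), ?_, ?_⟩, Finset.insert_erase he⟩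
      · intro f hf x hx
        obtain ⟨hne, hf⟩ := Finset.mem_erase.1 hf
        have hx' := h1.2 f hf _ he hne x hx
        simp only [Sym2.mem_iff, not_or] at hx'
        exact Finset.mem_erase.2 ⟨hx'.2, Finset.mem_erase.2 ⟨hx'.1, h2 f hf x hx⟩⟩
      · have := Finset.card_erase_add_one he
        omega
    · left
      push Not at hc
      refine ⟨h1, fun e he x hx => Finset.mem_erase.2 ⟨?_, h2 e he x hx⟩, h3⟩
      rintro rfl
      exact hc e he hx
  · rintro (⟨h1, h2, h3⟩ | ⟨u, ⟨huS, hadj⟩, N, ⟨h1, h2, h3⟩, rfl⟩)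
    · exact ⟨h1, fun e he x hx => Finset.mem_of_mem_erase (h2 e he x hx), h3⟩
    · have hdisj : ∀ f ∈ N, ∀ x ∈ f, x ∉ s(v, u) := by
        intro f hf x hx
        have := h2 f hf x hx
        simp only [Finset.mem_erase] at this
        simp [this.1, this.2.1]
      have hnot : s(v, u) ∉ N := fun h =>
        hdisj _ h v (Sym2.mem_mk_left v u) (Sym2.mem_mk_left v u)
      refine ⟨⟨?_, ?_⟩, ?_, ?_⟩
      · intro e he
        rcases Finset.mem_insert.1 he with rfl | he
        · exact hadj
        · exact h1.1 e he
      · intro e he f hf hef x hxe hxf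
        rcases Finset.mem_insert.1 he with rfl | he <;> rcases Finset.mem_insert.1 hf with rfl | hf
        · exact hef rfl
        · exact hdisj f hf x hxf hxe
        · exact hdisj e he x hxe hxf
        · exact h1.2 e he f hf hef x hxe hxf
      · intro e he x hx
        rcases Finset.mem_insert.1 he with rfl | he
        · rcases Sym2.mem_iff.1 hx with rfl | rfl
          · exact hv
          · exact Finset.mem_of_mem_erase huS
        · exact Finset.mem_of_mem_erase (Finset.mem_of_mem_erase (h2 e he x hx))
      · rw [Finset.card_insert_of_notMem hnot]
        push_cast
        omega

theorem matchingSeq_eq_add_sum {S : Finset V} {v : V} (hv : v ∈ S) :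
    matchingSeq G S = matchingSeq G (S.erase v) +
      ∑ u ∈ (S.erase v).filter (G.Adj v), shift (matchingSeq G ((S.erase v).erase u)) := by
  have hout : ∀ {u : V} {k : ℤ} {N : Finset (Sym2 V)},
      N ∈ matchingsIn G ((S.erase v).erase u) k → ∀ e ∈ N, v ∉ e := by
    intro u k N hN e he hve
    have := ((mem_matchingsIn G).1 hN).2.1 e he v hve
    simp at this
  ext k
  simp only [Pi.add_apply, Finset.sum_apply, shift, matchingSeq]
  rw [matchingsIn_eq_union G hv, Finset.card_union_of_disjoint, Finset.card_biUnion]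
  · push_cast
    congr 1
    refine Finset.sum_congr rfl fun u _ => ?_
    rw [Finset.card_image_of_injOn]
    intro N hN N' hN' h
    have hnot : ∀ {N}, N ∈ matchingsIn G ((S.erase v).erase u) (k - 1) → s(v, u) ∉ N :=
      fun hN he => hout hN _ he (Sym2.mem_mk_left v u)
    rw [← Finset.erase_insert (hnot hN), ← Finset.erase_insert (hnot hN')]
    exact congrArg (Finset.erase · s(v, u)) h
  · intro u _ w _ huw
    refine Finset.disjoint_left.2 fun M hM hM' => ?_
    obtain ⟨N, hN, rfl⟩ := Finset.mem_image.1 hM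
    obtain ⟨N', hN', h⟩ := Finset.mem_image.1 hM'
    have hmem : s(v, u) ∈ insert s(v, w) N' := h ▸ Finset.mem_insert_self _ _
    rcases Finset.mem_insert.1 hmem with h | h
    · exact huw (Sym2.congr_right.1 h)
    · exact hout hN' _ h (Sym2.mem_mk_left v u)
  · refine Finset.disjoint_left.2 fun M hM hM' => ?_
    obtain ⟨u, -, hu⟩ := Finset.mem_biUnion.1 hM'
    obtain ⟨N, -, rfl⟩ := Finset.mem_image.1 hu
    have := ((mem_matchingsIn G).1 hM).2.1 s(v, u) (Finset.mem_insert_self _ _) v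
      (Sym2.mem_mk_left v u)
    simp at this

/-- The inequalities, closed under adding a vertex, that give the log-concavity of the matching
numbers inside `S`. -/
structure MatchingLogConc (S : Finset V) : Prop where
  self : ∀ k, 0 ≤ logConcForm k (matchingSeq G S) (matchingSeq G S)
  erase : ∀ u ∈ S, ∀ k, 0 ≤ logConcForm k (matchingSeq G S) (matchingSeq G (S.erase u))
  shift_erase : ∀ u ∈ S, ∀ k,
    0 ≤ logConcForm k (matchingSeq G S) (shift (matchingSeq G (S.erase u)))
  erase_erase : ∀ u ∈ S, ∀ w ∈ S, ∀ k,
    0 ≤ logConcForm k (matchingSeq G (S.erase u)) (matchingSeq G (S.erase w))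

/-- The two sums are the matching sequences of one-vertex extensions of `K`. -/
theorem MatchingLogConc.extend {G : SimpleGraph V} {K A B : Finset V} (hK : MatchingLogConc G K) (hA : A ⊆ K)
    (hB : B ⊆ K) (k : ℤ) :
    0 ≤ logConcForm k (matchingSeq G K + ∑ t ∈ A, shift (matchingSeq G (K.erase t)))
      (matchingSeq G K + ∑ s ∈ B, shift (matchingSeq G (K.erase s))) := by
  simp only [map_add, map_sum, LinearMap.add_apply, LinearMap.sum_apply]
  refine add_nonneg (add_nonneg (hK.self k) (Finset.sum_nonneg fun t ht => ?_))
    (Finset.sum_nonneg fun s hs => add_nonneg (hK.shift_erase s (hB hs) k)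
      (Finset.sum_nonneg fun t ht => ?_))
  · rw [logConcForm_comm]
    exact hK.shift_erase t (hA ht) k
  · rw [logConcForm_shift_shift]
    exact hK.erase_erase t (hA ht) s (hB hs) _

theorem matchingLogConc (S : Finset V) : MatchingLogConc G S := by
  induction S using Finset.strongInduction with
  | H S ih =>
    have hself : ∀ k, 0 ≤ logConcForm k (matchingSeq G S) (matchingSeq G S) := by
      intro k
      rcases S.eq_empty_or_nonempty with rfl | ⟨v, hv⟩
      · simp only [logConcForm_apply, matchingSeq_empty]
        split_ifs <;> omega
      · rw [matchingSeq_eq_add_sum G hv]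
        exact (ih _ (Finset.erase_ssubset hv)).extend (Finset.filter_subset _ _)
          (Finset.filter_subset _ _) k
    refine ⟨hself, fun u hu k => ?_, fun u hu k => ?_, fun u hu w hw k => ?_⟩
    · have h := (ih _ (Finset.erase_ssubset hu)).extend (Finset.filter_subset (G.Adj u) _)
        (Finset.empty_subset _) k
      rwa [Finset.sum_empty, add_zero, ← matchingSeq_eq_add_sum G hu] at h
    · have hK := ih _ (Finset.erase_ssubset hu)
      rw [matchingSeq_eq_add_sum G hu]
      simp only [map_add, map_sum, LinearMap.add_apply, LinearMap.sum_apply]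
      refine add_nonneg (logConcForm_self_shift_nonneg (matchingSeq_nonneg G _)
        (matchingSeq_of_neg G _) (matchingSeq_pos_of_succ G _) hK.self k)
        (Finset.sum_nonneg fun t ht => ?_)
      rw [logConcForm_shift_shift, logConcForm_comm]
      exact hK.erase t (Finset.mem_of_mem_filter t ht) _
    · rcases eq_or_ne u w with rfl | huw
      · exact (ih _ (Finset.erase_ssubset hu)).self k
      · have hw' : w ∈ S.erase u := Finset.mem_erase.2 ⟨huw.symm, hw⟩
        have hu' : u ∈ S.erase w := Finset.mem_erase.2 ⟨huw, hu⟩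
        rw [matchingSeq_eq_add_sum G hw', matchingSeq_eq_add_sum G hu',
          Finset.erase_right_comm (a := w)]
        exact (ih _ ((Finset.erase_ssubset hw').trans (Finset.erase_ssubset hu))).extend
          (Finset.filter_subset _ _) (Finset.filter_subset _ _) k

theorem mCount_eq_matchingSeq (k : ℕ) : (mCount G k : ℤ) = matchingSeq G Finset.univ k := by
  simp [mCount, matchingSeq, matchingsIn]

end MatchingSeq

/-- For any finite simple graph `G = (V,E)` and any integer `k` with `1 ≤ k ≤ |V|/2`,
the numbers of matchings by size are log-concave: `m_{k-1}·m_{k+1} ≤ m_k²`. -/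
theorem stmt6 {V : Type*} [Fintype V] (G : SimpleGraph V) (k : ℕ)
    (hk1 : 1 ≤ k) (hk2 : k ≤ Fintype.card V / 2) :
    mCount G (k - 1) * mCount G (k + 1) ≤ mCount G k ^ 2 := by
  have h := (matchingLogConc G Finset.univ).self k
  obtain ⟨n, rfl⟩ : ∃ n, k = n + 1 := ⟨k - 1, by omega⟩
  zify
  simp only [mCount_eq_matchingSeq, logConcForm_apply] at *
  push_cast [add_sub_cancel_right] at *
  linarith
end

section
/- For every finite simple graph G with n=|V|≥1, every c>0, and every integer k with 1 ≤ k ≤ n, one has Z_{k-1} ≤ 2n²·Z_k for the weighted matching counts of G□K₂. -/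
open scoped Classical

/-- The weight of a set of edges `M` of `G □ K₂`: `c ^ (2t)` where `t` is the number of
copy edges (edges lying within one of the two copies of `G`) in `M`. -/
noncomputable def wK2 {V : Type*} (c : ℝ) (M : Finset (Sym2 (V × Fin 2))) : ℝ :=
  c ^ (2 * (M.filter fun e => (Sym2.map Prod.snd e).IsDiag).card)

/-- `Zk G c k` is the total weight of the `k`-edge matchings of `G □ K₂`,
where copy edges have weight `c ^ 2` and rung edges have weight `1`. -/
noncomputable def Zk {V : Type*} [Fintype V] (G : SimpleGraph V) (c : ℝ) (k : ℕ) : ℝ :=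
  ∑ M ∈ Finset.univ.filter (fun M : Finset (Sym2 (V × Fin 2)) =>
      IsMatchingSet (G.boxProd (⊤ : SimpleGraph (Fin 2))) M ∧ M.card = k), wK2 c M

open Polynomial

/-- The edge-weighted matchings of the complete graph supported on the vertex set `T`. -/
noncomputable def matchingsOn {α : Type*} [DecidableEq α] (T : Finset α) :
    Finset (Finset (Sym2 α)) :=
  T.sym2.powerset.filter (IsMatchingSet (⊤ : SimpleGraph α))

/-- The vertices of `T` left uncovered by `M`. -/
noncomputable def uncovered {α : Type*} [DecidableEq α] (T : Finset α) (M : Finset (Sym2 α)) :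
    Finset α :=
  T.filter fun x => ∀ e ∈ M, x ∉ e

/-- The matching polynomial (with positive signs) of the weighted complete graph on `T`;
the exponent of `X` counts the uncovered vertices. -/
noncomputable def matchPoly {α : Type*} [DecidableEq α] (w : Sym2 α → ℝ) (T : Finset α) : ℝ[X] :=
  ∑ M ∈ matchingsOn T, C (∏ e ∈ M, w e) * X ^ (uncovered T M).card

section MatchPoly

variable {α : Type*} [DecidableEq α] {w : Sym2 α → ℝ} {T : Finset α} {M : Finset (Sym2 α)}

lemma mem_matchingsOn : M ∈ matchingsOn T ↔
    (∀ e ∈ M, ∀ x ∈ e, x ∈ T) ∧ (∀ e ∈ M, ¬ e.IsDiag) ∧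
      ∀ e ∈ M, ∀ f ∈ M, e ≠ f → ∀ v, v ∈ e → v ∉ f := by
  simp [matchingsOn, IsMatchingSet, Finset.subset_iff, Finset.mem_sym2_iff]

lemma card_uncovered_add (hM : M ∈ matchingsOn T) :
    (uncovered T M).card + 2 * M.card = T.card := by
  obtain ⟨h1, h2, h3⟩ := mem_matchingsOn.1 hM
  have hc : (M.biUnion Sym2.toFinset).card = 2 * M.card := by
    rw [Finset.card_biUnion, Finset.sum_congr rfl
      (fun e he => Sym2.card_toFinset_of_not_isDiag e (h2 e he))]
    · simp [mul_comm]
    · intro e he f hf hef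
      rw [Function.onFun, Finset.disjoint_left]
      simpa using h3 e he f hf hef
  have hu : uncovered T M = T \ M.biUnion Sym2.toFinset := by
    ext x; simp [uncovered]
  have hs : M.biUnion Sym2.toFinset ⊆ T := by
    intro x; simp only [Finset.mem_biUnion, Sym2.mem_toFinset]
    rintro ⟨e, he, hx⟩; exact h1 e he x hx
  rw [hu, Finset.card_sdiff_of_subset hs, ← hc]
  exact Nat.sub_add_cancel (Finset.card_le_card hs)

lemma matchPoly_empty : matchPoly w ∅ = 1 := by
  have : matchingsOn (∅ : Finset α) = {∅} := by
    ext M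
    simp [matchingsOn, IsMatchingSet, Finset.filter_singleton]
  simp [matchPoly, this, uncovered]

lemma matchingsOn_filter_uncovered {v : α} :
    (matchingsOn T).filter (fun M => ∀ e ∈ M, v ∉ e) = matchingsOn (T.erase v) := by
  ext M
  simp only [Finset.mem_filter, mem_matchingsOn, Finset.mem_erase]
  grind

lemma sum_matchingsOn_mem {v u : α} (hv : v ∈ T) (hu : u ∈ T.erase v) :
    ∑ M ∈ (matchingsOn T).filter (fun M => s(v, u) ∈ M),
      C (∏ e ∈ M, w e) * X ^ (uncovered T M).card =
    C (w s(v, u)) * matchPoly w ((T.erase v).erase u) := by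
  have hvu : u ≠ v := (Finset.mem_erase.1 hu).1
  have huT : u ∈ T := (Finset.mem_erase.1 hu).2
  have hnot : ∀ M ∈ matchingsOn ((T.erase v).erase u), s(v, u) ∉ M := by
    intro M hM h
    have := (mem_matchingsOn.1 hM).1 _ h v (by simp)
    simp at this
  rw [matchPoly, Finset.mul_sum]
  refine Finset.sum_nbij' (fun M => M.erase s(v, u)) (fun M => insert s(v, u) M) ?_ ?_ ?_ ?_ ?_
  · intro M hM
    simp only [Finset.mem_filter, mem_matchingsOn] at hM
    obtain ⟨⟨h1, h2, h3⟩, h4⟩ := hM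
    simp only [mem_matchingsOn, Finset.mem_erase]
    refine ⟨fun e he x hx => ⟨?_, ?_, h1 e he.2 x hx⟩, fun e he => h2 e he.2,
      fun e he f hf => h3 e he.2 f hf.2⟩
    · rintro rfl; exact h3 e he.2 _ h4 he.1 x hx (by simp)
    · rintro rfl; exact h3 e he.2 _ h4 he.1 x hx (by simp)
  · intro M hM
    obtain ⟨h1, h2, h3⟩ := mem_matchingsOn.1 hM
    have hd : ∀ e ∈ M, ∀ x ∈ s(v, u), x ∉ e := by
      intro e he x hx hxe
      have := h1 e he x hxe
      simp only [Finset.mem_erase] at this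
      rcases Sym2.mem_iff.1 hx with rfl | rfl
      · exact this.2.1 rfl
      · exact this.1 rfl
    simp only [Finset.mem_filter, mem_matchingsOn, Finset.mem_insert, true_or, and_true]
    refine ⟨?_, ?_, ?_⟩
    · rintro e (rfl | he) x hx
      · rcases Sym2.mem_iff.1 hx with rfl | rfl <;> assumption
      · exact Finset.mem_of_mem_erase (Finset.mem_of_mem_erase (h1 e he x hx))
    · rintro e (rfl | he)
      · simpa using hvu.symm
      · exact h2 e he
    · rintro e (rfl | he) f (rfl | hf) hef x hx
      · exact absurd rfl hef
      · exact hd f hf x hx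
      · exact fun h => hd e he x h hx
      · exact h3 e he f hf hef x hx
  · intro M hM
    exact Finset.insert_erase (Finset.mem_filter.1 hM).2
  · intro M hM
    exact Finset.erase_insert (hnot M hM)
  · intro M hM
    obtain ⟨hM, h4⟩ := Finset.mem_filter.1 hM
    obtain ⟨h1, h2, h3⟩ := mem_matchingsOn.1 hM
    have : uncovered ((T.erase v).erase u) (M.erase s(v, u)) = uncovered T M := by
      ext x
      simp only [uncovered, Finset.mem_filter, Finset.mem_erase]
      constructor
      · rintro ⟨⟨hxu, hxv, hx⟩, h⟩
        refine ⟨hx, fun e he => ?_⟩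
        by_cases heq : e = s(v, u)
        · subst heq; simp [hxu, hxv]
        · exact h e ⟨heq, he⟩
      · rintro ⟨hx, h⟩
        have := h _ h4
        simp only [Sym2.mem_iff, not_or] at this
        exact ⟨⟨this.2, this.1, hx⟩, fun e he => h e he.2⟩
    rw [this, ← Finset.mul_prod_erase M w h4, C_mul, mul_assoc]

lemma matchPoly_rec {v : α} (hv : v ∈ T) :
    matchPoly w T = X * matchPoly w (T.erase v) +
      ∑ u ∈ T.erase v, C (w s(v, u)) * matchPoly w ((T.erase v).erase u) := by
  rw [← Finset.sum_congr rfl fun u hu => sum_matchingsOn_mem (w := w) hv hu]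
  simp_rw [Finset.sum_filter]
  rw [Finset.sum_comm, matchPoly,
    ← Finset.sum_filter_add_sum_filter_not _ (fun M => ∀ e ∈ M, v ∉ e)]
  congr 1
  · rw [matchingsOn_filter_uncovered, matchPoly, Finset.mul_sum]
    refine Finset.sum_congr rfl fun M hM => ?_
    have : uncovered T M = insert v (uncovered (T.erase v) M) := by
      have := (mem_matchingsOn.1 hM).1
      ext x
      simp only [uncovered, Finset.mem_filter, Finset.mem_erase, Finset.mem_insert] at *
      grind
    rw [this, Finset.card_insert_of_notMem (by simp [uncovered])]
    ring
  · rw [Finset.sum_filter]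
    refine Finset.sum_congr rfl fun M hM => ?_
    obtain ⟨h1, h2, h3⟩ := mem_matchingsOn.1 hM
    split_ifs with h
    · symm
      apply Finset.sum_eq_zero
      intro u hu
      rw [if_neg]
      intro h'
      exact h _ h' (by simp)
    · push Not at h
      obtain ⟨e, he, hve⟩ := h
      obtain ⟨u, rfl⟩ := hve
      rw [Finset.sum_eq_single u, if_pos he]
      · intro u' hu' hne
        rw [if_neg]
        intro h'
        refine h3 _ he _ h' ?_ v (by simp) (by simp)
        exact fun h => hne (Sym2.congr_right.1 h).symm
      · intro hu
        exfalso
        apply hu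
        rw [Finset.mem_erase]
        exact ⟨fun h => h2 _ he (by simp [h]), h1 _ he u (by simp)⟩

lemma derivative_matchPoly (T : Finset α) :
    derivative (matchPoly w T) = ∑ t ∈ T, matchPoly w (T.erase t) := by
  induction T using Finset.strongInduction with
  | H T ih =>
    rcases T.eq_empty_or_nonempty with rfl | ⟨v, hv⟩
    · simp [matchPoly_empty]
    rw [← Finset.add_sum_erase _ _ hv]
    have hrec : ∀ t ∈ T.erase v, matchPoly w (T.erase t) =
        X * matchPoly w ((T.erase v).erase t) + ∑ u ∈ (T.erase v).erase t,
          C (w s(v, u)) * matchPoly w (((T.erase v).erase t).erase u) := by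
      intro t ht
      rw [matchPoly_rec (v := v) (by simp_all [eq_comm]), Finset.erase_right_comm]
    rw [Finset.sum_congr rfl hrec, matchPoly_rec hv, derivative_add, derivative_mul,
      derivative_sum, derivative_X, one_mul, ih _ (Finset.erase_ssubset hv), Finset.mul_sum,
      Finset.sum_add_distrib, add_assoc]
    congr 2
    have hd : ∀ u ∈ T.erase v, derivative (C (w s(v, u)) * matchPoly w ((T.erase v).erase u)) =
        ∑ t ∈ (T.erase v).erase u,
          C (w s(v, u)) * matchPoly w (((T.erase v).erase u).erase t) := by
      intro u hu
      rw [derivative_C_mul, ih _ ((Finset.erase_subset _ _).trans_ssubset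
        (Finset.erase_ssubset hv)), Finset.mul_sum]
    rw [Finset.sum_congr rfl hd, Finset.sum_comm' (t' := T.erase v)
      (s' := fun t => (T.erase v).erase t) (by intro x y; simp only [Finset.mem_erase]; grind)]
    simp_rw [Finset.erase_right_comm]

lemma aeval_matchPoly_ne_zero (hw : ∀ e, 0 ≤ w e) {z : ℂ} (hz : 0 < z.re) (T : Finset α) :
    aeval z (matchPoly w T) ≠ 0 ∧
      ∀ v ∈ T, 0 < (aeval z (matchPoly w T) / aeval z (matchPoly w (T.erase v))).re := by
  induction T using Finset.strongInduction with
  | H T ih =>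
    have key : ∀ v ∈ T,
        0 < (aeval z (matchPoly w T) / aeval z (matchPoly w (T.erase v))).re := by
      intro v hv
      obtain ⟨h0, hre⟩ := ih _ (Finset.erase_ssubset hv)
      have : aeval z (matchPoly w T) / aeval z (matchPoly w (T.erase v)) =
          z + ∑ u ∈ T.erase v, (w s(v, u) : ℂ) *
            (aeval z (matchPoly w (T.erase v)) /
              aeval z (matchPoly w ((T.erase v).erase u)))⁻¹ := by
        rw [matchPoly_rec hv, map_add, map_mul, aeval_X, map_sum, add_div,
          mul_div_cancel_right₀ _ h0, Finset.sum_div]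
        congr 1
        refine Finset.sum_congr rfl fun u _ => ?_
        rw [map_mul, aeval_C, inv_div, mul_div_assoc]
        rfl
      rw [this, Complex.add_re, Complex.re_sum]
      refine add_pos_of_pos_of_nonneg hz (Finset.sum_nonneg fun u hu => ?_)
      rw [Complex.re_ofReal_mul, Complex.inv_re]
      exact mul_nonneg (hw _) (div_nonneg (hre u hu).le (Complex.normSq_nonneg _))
    refine ⟨?_, key⟩
    rcases T.eq_empty_or_nonempty with rfl | ⟨v, hv⟩
    · simp [matchPoly_empty]
    · intro h
      have := key v hv
      simp [h] at this

lemma coeff_zero_matchPoly_nonneg (hw : ∀ e, 0 ≤ w e) (T : Finset α) :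
    0 ≤ (matchPoly w T).coeff 0 := by
  rw [matchPoly, finsetSum_coeff]
  refine Finset.sum_nonneg fun M _ => ?_
  rw [coeff_C_mul, coeff_X_pow]
  exact mul_nonneg (Finset.prod_nonneg fun e _ => hw e) (by split_ifs <;> norm_num)

lemma coeff_one_matchPoly (T : Finset α) :
    (matchPoly w T).coeff 1 = ∑ t ∈ T, (matchPoly w (T.erase t)).coeff 0 := by
  rw [← finsetSum_coeff, ← derivative_matchPoly, coeff_derivative]
  simp

lemma two_mul_coeff_two_matchPoly (T : Finset α) :
    2 * (matchPoly w T).coeff 2 =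
      ∑ t ∈ T, ∑ u ∈ T.erase t, (matchPoly w ((T.erase t).erase u)).coeff 0 := by
  simp_rw [← coeff_one_matchPoly]
  rw [← finsetSum_coeff, ← derivative_matchPoly, coeff_derivative]
  norm_num [mul_comm]

end MatchPoly

section Prism

variable {V : Type*} [DecidableEq V] {w : Sym2 V → ℝ} {w' : Sym2 (V × Fin 2) → ℝ}

lemma prism_swap_sum (A B : Finset V) :
    (∑ R ∈ (A ∩ B).powerset, matchPoly w (A \ R) * matchPoly w (B \ R)) =
      ∑ R ∈ (B ∩ A).powerset, matchPoly w (B \ R) * matchPoly w (A \ R) := by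
  rw [Finset.inter_comm]
  exact Finset.sum_congr rfl fun R _ => mul_comm _ _

/-- Vertex recursion for `∑ R ⊆ A ∩ B, matchPoly (A \ R) * matchPoly (B \ R)`. -/
lemma sum_powerset_matchPoly_rec {A B : Finset V} {v : V} (hv : v ∈ A) :
    (∑ R ∈ (A ∩ B).powerset, matchPoly w (A \ R) * matchPoly w (B \ R)) =
      X * (∑ R ∈ (A.erase v ∩ B).powerset, matchPoly w (A.erase v \ R) * matchPoly w (B \ R)) +
      (∑ u ∈ A.erase v, C (w s(v, u)) *
        ∑ R ∈ ((A.erase v).erase u ∩ B).powerset,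
          matchPoly w ((A.erase v).erase u \ R) * matchPoly w (B \ R)) +
      if v ∈ B then ∑ R ∈ (A.erase v ∩ B.erase v).powerset,
        matchPoly w (A.erase v \ R) * matchPoly w (B.erase v \ R) else 0 := by
  have hne : ∀ R ∈ (A.erase v ∩ B).powerset, matchPoly w (A \ R) * matchPoly w (B \ R) =
      X * (matchPoly w (A.erase v \ R) * matchPoly w (B \ R)) +
      ∑ u ∈ A.erase v \ R, C (w s(v, u)) *
        (matchPoly w ((A.erase v).erase u \ R) * matchPoly w (B \ R)) := by
    intro R hR
    have hvR : v ∉ R := fun h => by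
      have := Finset.mem_powerset.1 hR h
      simp at this
    have e1 : (A \ R).erase v = A.erase v \ R := by grind
    rw [matchPoly_rec (v := v) (by simp [hv, hvR]), e1, add_mul, Finset.sum_mul, mul_assoc]
    refine congrArg _ (Finset.sum_congr rfl fun u _ => ?_)
    rw [mul_assoc, show (A.erase v \ R).erase u = (A.erase v).erase u \ R by grind]
  have hsum : (∑ R ∈ (A.erase v ∩ B).powerset, matchPoly w (A \ R) * matchPoly w (B \ R)) =
      X * (∑ R ∈ (A.erase v ∩ B).powerset, matchPoly w (A.erase v \ R) * matchPoly w (B \ R)) +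
      (∑ u ∈ A.erase v, C (w s(v, u)) *
        ∑ R ∈ ((A.erase v).erase u ∩ B).powerset,
          matchPoly w ((A.erase v).erase u \ R) * matchPoly w (B \ R)) := by
    rw [Finset.sum_congr rfl hne, Finset.sum_add_distrib, Finset.mul_sum]
    refine congrArg _ ?_
    simp_rw [Finset.mul_sum]
    refine Finset.sum_comm' fun R u => ?_
    simp only [Finset.mem_powerset, Finset.mem_sdiff]
    constructor
    · rintro ⟨h1, h2, h3⟩
      refine ⟨fun x hx => ?_, h2⟩
      have := h1 hx
      simp only [Finset.mem_inter, Finset.mem_erase] at this ⊢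
      exact ⟨⟨fun h => h3 (h ▸ hx), this.1⟩, this.2⟩
    · rintro ⟨h1, h2⟩
      refine ⟨fun x hx => ?_, h2, fun hx => ?_⟩
      · have := h1 hx
        simp only [Finset.mem_inter, Finset.mem_erase] at this ⊢
        exact ⟨this.1.2, this.2⟩
      · have := h1 hx
        simp at this
  rw [← hsum]
  split_ifs with hB
  · have hins : A ∩ B = insert v (A.erase v ∩ B.erase v) := by grind
    have hAB : A.erase v ∩ B = A.erase v ∩ B.erase v := by grind
    rw [hAB, hins, Finset.sum_powerset_insert (by simp)]
    refine congrArg _ (Finset.sum_congr rfl fun R _ => ?_)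
    rw [show A \ insert v R = A.erase v \ R by grind, show B \ insert v R = B.erase v \ R by grind]
  · rw [add_zero, show A.erase v ∩ B = A ∩ B by grind]

lemma erase_layer {i : Fin 2} (A B : Finset V) (v : V) :
    (A ×ˢ {i} ∪ B ×ˢ {1 - i}).erase (v, i) = A.erase v ×ˢ {i} ∪ B ×ˢ {1 - i} := by
  have : i ≠ 1 - i := by decide +revert
  generalize 1 - i = i' at *
  ext ⟨x, j⟩
  simp only [Finset.mem_erase, Finset.mem_union, Finset.mem_product, Finset.mem_singleton,
    Prod.mk.injEq, ne_eq]
  grind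

lemma erase_other_layer {i : Fin 2} (A B : Finset V) (v : V) :
    (A ×ˢ {i} ∪ B ×ˢ {1 - i}).erase (v, 1 - i) = A ×ˢ {i} ∪ B.erase v ×ˢ {1 - i} := by
  have : i ≠ 1 - i := by decide +revert
  generalize 1 - i = i' at *
  ext ⟨x, j⟩
  simp only [Finset.mem_erase, Finset.mem_union, Finset.mem_product, Finset.mem_singleton,
    Prod.mk.injEq, ne_eq]
  grind

lemma matchPoly_prism_rec (hcopy : ∀ u v i, u ≠ v → w' s((u, i), (v, i)) = w s(u, v))
    (hrung : ∀ v i, w' s((v, i), (v, 1 - i)) = 1)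
    (hzero : ∀ u v i, u ≠ v → w' s((u, i), (v, 1 - i)) = 0)
    {i : Fin 2} {A B : Finset V} {v : V} (hv : v ∈ A) :
    matchPoly w' (A ×ˢ {i} ∪ B ×ˢ {1 - i}) =
      X * matchPoly w' (A.erase v ×ˢ {i} ∪ B ×ˢ {1 - i}) +
      (∑ u ∈ A.erase v, C (w s(v, u)) *
        matchPoly w' ((A.erase v).erase u ×ˢ {i} ∪ B ×ˢ {1 - i})) +
      if v ∈ B then matchPoly w' (A.erase v ×ˢ {i} ∪ B.erase v ×ˢ {1 - i}) else 0 := by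
  have hi : i ≠ 1 - i := by decide +revert
  rw [matchPoly_rec (v := (v, i)) (by simp [hv]), erase_layer, Finset.sum_union, add_assoc,
    Finset.sum_product, Finset.sum_product]
  · simp only [Finset.sum_singleton, erase_layer, erase_other_layer]
    congr 2
    · refine Finset.sum_congr rfl fun u hu => ?_
      rw [hcopy _ _ _ (Finset.ne_of_mem_erase hu).symm]
    · rw [← Finset.sum_ite_eq B v
        (fun u => matchPoly w' (A.erase v ×ˢ {i} ∪ B.erase u ×ˢ {1 - i}))]
      refine Finset.sum_congr rfl fun u hu => ?_
      split_ifs with h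
      · subst h; simp [hrung]
      · simp [hzero _ _ _ h]
  · rw [Finset.disjoint_left]
    rintro ⟨x, j⟩
    simp only [Finset.mem_product, Finset.mem_singleton]
    rintro ⟨_, rfl⟩ ⟨_, h⟩
    exact hi h

lemma matchPoly_prism (hcopy : ∀ u v i, u ≠ v → w' s((u, i), (v, i)) = w s(u, v))
    (hrung : ∀ v i, w' s((v, i), (v, 1 - i)) = 1)
    (hzero : ∀ u v i, u ≠ v → w' s((u, i), (v, 1 - i)) = 0)
    (i : Fin 2) (A B : Finset V) :
    matchPoly w' (A ×ˢ {i} ∪ B ×ˢ {1 - i}) =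
      ∑ R ∈ (A ∩ B).powerset, matchPoly w (A \ R) * matchPoly w (B \ R) := by
  have main : ∀ N, ∀ (i : Fin 2) (A B : Finset V), A.card + B.card = N →
      matchPoly w' (A ×ˢ {i} ∪ B ×ˢ {1 - i}) =
        ∑ R ∈ (A ∩ B).powerset, matchPoly w (A \ R) * matchPoly w (B \ R) := by
    intro N
    induction N using Nat.strong_induction_on with
    | _ N ih =>
      have step : ∀ (i : Fin 2) (A B : Finset V), A.card + B.card = N → A.Nonempty →
          matchPoly w' (A ×ˢ {i} ∪ B ×ˢ {1 - i}) =
            ∑ R ∈ (A ∩ B).powerset, matchPoly w (A \ R) * matchPoly w (B \ R) := by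
        rintro i A B hN ⟨v, hv⟩
        have h1 := Finset.card_erase_lt_of_mem hv
        rw [matchPoly_prism_rec hcopy hrung hzero hv, sum_powerset_matchPoly_rec hv,
          ih _ (by omega) _ _ _ rfl]
        refine congrArg₂ _ (congrArg _ ?_) ?_
        · refine Finset.sum_congr rfl fun u _ => ?_
          have h2 := Finset.card_erase_le (s := A.erase v) (a := u)
          rw [ih _ (by omega) _ _ _ rfl]
        · have h2 := Finset.card_erase_le (s := B) (a := v)
          rw [ih _ (by omega) _ _ _ rfl]
      intro i A B hN
      rcases A.eq_empty_or_nonempty with rfl | hA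
      · rcases B.eq_empty_or_nonempty with rfl | hB
        · simp [matchPoly_empty]
        · have := step (1 - i) B ∅ (by omega) hB
          rw [sub_sub_cancel, Finset.union_comm] at this
          rw [this, prism_swap_sum]
      · exact step i A B hN hA
  exact main _ i A B rfl

lemma matchPoly_prism_univ [Fintype V]
    (hcopy : ∀ u v i, u ≠ v → w' s((u, i), (v, i)) = w s(u, v))
    (hrung : ∀ v i, w' s((v, i), (v, 1 - i)) = 1)
    (hzero : ∀ u v i, u ≠ v → w' s((u, i), (v, 1 - i)) = 0) :
    matchPoly w' Finset.univ = ∑ S : Finset V, matchPoly w S ^ 2 := by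
  have hu : (Finset.univ : Finset (V × Fin 2)) =
      Finset.univ ×ˢ {0} ∪ Finset.univ ×ˢ {1 - 0} := by
    ext ⟨x, j⟩
    fin_cases j <;> simp
  rw [hu, matchPoly_prism hcopy hrung hzero, Finset.univ_inter, Finset.powerset_univ]
  refine Fintype.sum_bijective _ compl_bijective _ _ fun R => ?_
  rw [sq, Finset.compl_eq_univ_sdiff]

end Prism

section CauchySchwarz

variable {V : Type*} [DecidableEq V] [Fintype V]

lemma sum_ite_mul_le {f : Finset V → ℝ} (p : Finset V → Prop) [DecidablePred p]
    {g h : Finset V → Finset V}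
    (hg : Set.InjOn g {S | p S}) (hh : Set.InjOn h {S | p S}) :
    (∑ S, if p S then f (g S) * f (h S) else 0) ≤ ∑ S, f S ^ 2 := by
  have key : ∀ g : Finset V → Finset V, Set.InjOn g {S | p S} →
      ∑ S ∈ Finset.univ.filter p, f (g S) ^ 2 ≤ ∑ S, f S ^ 2 := by
    intro g hg
    rw [← Finset.sum_image (f := fun S => f S ^ 2) (by simpa using hg)]
    exact Finset.sum_le_sum_of_subset_of_nonneg (Finset.subset_univ _)
      fun S _ _ => sq_nonneg _
  rw [← Finset.sum_filter]
  have : ∑ S ∈ Finset.univ.filter p, f (g S) * f (h S) ≤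
      ∑ S ∈ Finset.univ.filter p, (f (g S) ^ 2 + f (h S) ^ 2) / 2 :=
    Finset.sum_le_sum fun S _ => by nlinarith [sq_nonneg (f (g S) - f (h S))]
  rw [← Finset.sum_div, Finset.sum_add_distrib] at this
  linarith [key g hg, key h hh]

lemma sum_sq_coeff_two_le (w : Sym2 V → ℝ) :
    (∑ S : Finset V, matchPoly w S ^ 2).coeff 2 ≤
      2 * (Fintype.card V : ℝ) ^ 2 * (∑ S : Finset V, matchPoly w S ^ 2).coeff 0 := by
  set b : Finset V → ℝ := fun S => (matchPoly w S).coeff 0 with hb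
  have h0 : (∑ S : Finset V, matchPoly w S ^ 2).coeff 0 = ∑ S, b S ^ 2 := by
    rw [finsetSum_coeff]
    exact Finset.sum_congr rfl fun S _ => by rw [sq, mul_coeff_zero, sq]
  have h2 : (∑ S : Finset V, matchPoly w S ^ 2).coeff 2 =
      ∑ t : V, ∑ u : V, ((∑ S : Finset V, if t ∈ S ∧ u ∈ S then
          b (S.erase t) * b (S.erase u) else 0) +
        ∑ S : Finset V, if t ∈ S ∧ u ∈ S.erase t then
          b S * b ((S.erase t).erase u) else 0) := by
    simp_rw [← Finset.sum_add_distrib]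
    rw [Finset.sum_congr rfl fun t _ => Finset.sum_comm, Finset.sum_comm, finsetSum_coeff]
    refine Finset.sum_congr rfl fun S _ => ?_
    have hc : (matchPoly w S ^ 2).coeff 2 = (matchPoly w S).coeff 1 * (matchPoly w S).coeff 1 +
        b S * (2 * (matchPoly w S).coeff 2) := by
      rw [sq, coeff_mul, Finset.Nat.sum_antidiagonal_eq_sum_range_succ_mk]
      simp [Finset.sum_range_succ, hb]
      ring
    rw [hc, two_mul_coeff_two_matchPoly, coeff_one_matchPoly, Finset.sum_mul_sum, Finset.mul_sum]
    simp_rw [Finset.sum_add_distrib, ite_and, Finset.mul_sum]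
    congr 1
    · rw [← Fintype.sum_ite_mem]
      refine Finset.sum_congr rfl fun t _ => ?_
      split_ifs <;> simp [hb]
    · rw [← Fintype.sum_ite_mem]
      refine Finset.sum_congr rfl fun t _ => ?_
      split_ifs <;> simp only [Fintype.sum_ite_mem, Finset.sum_const_zero, hb]
  rw [h0, h2]
  calc _ ≤ ∑ t : V, ∑ u : V, ((∑ S, b S ^ 2) + ∑ S, b S ^ 2) := by
        refine Finset.sum_le_sum fun t _ => Finset.sum_le_sum fun u _ => add_le_add ?_ ?_
        · refine sum_ite_mul_le (g := fun S => S.erase t) (h := fun S => S.erase u) _ ?_ ?_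
          · exact fun S hS S' hS' h => by
              beta_reduce at h
              rw [← Finset.insert_erase hS.1, ← Finset.insert_erase hS'.1, h]
          · exact fun S hS S' hS' h => by
              beta_reduce at h
              rw [← Finset.insert_erase hS.2, ← Finset.insert_erase hS'.2, h]
        · refine sum_ite_mul_le (g := fun S => S) (h := fun S => (S.erase t).erase u) _ ?_ ?_
          · exact fun S _ S' _ h => h
          · exact fun S hS S' hS' h => by
              beta_reduce at h
              rw [← Finset.insert_erase hS.1, ← Finset.insert_erase hS'.1,
                ← Finset.insert_erase hS.2, ← Finset.insert_erase hS'.2, h]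
    _ = _ := by
        simp only [Finset.sum_const, Finset.card_univ, nsmul_eq_mul]
        ring

end CauchySchwarz

/-- If all complex roots of a real polynomial with positive constant term are negative reals,
its coefficients satisfy `p_{d+1} p_0 ≤ p_1 p_d`. -/
lemma coeff_succ_mul_coeff_zero_le (p : ℝ[X]) (h0 : 0 < p.coeff 0)
    (hroot : ∀ y : ℂ, aeval y p = 0 → ∃ s : ℝ, 0 < s ∧ y = -(s : ℂ)) :
    (∀ d, 0 ≤ p.coeff d) ∧ ∀ d, p.coeff (d + 1) * p.coeff 0 ≤ p.coeff 1 * p.coeff d := by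
  induction hN : p.natDegree using Nat.strong_induction_on generalizing p with
  | _ N ih =>
    rcases Nat.eq_zero_or_pos N with rfl | hpos
    · rw [eq_C_of_natDegree_eq_zero hN] at h0 ⊢
      rw [coeff_C_zero] at h0
      refine ⟨fun d => ?_, fun d => by simp [coeff_C]⟩
      rw [coeff_C]
      split_ifs <;> simp [h0.le]
    obtain ⟨y, hy⟩ := Complex.exists_root (f := p.map (algebraMap ℝ ℂ))
      (by rw [degree_map]; exact natDegree_pos_iff_degree_pos.1 (hN ▸ hpos))
    rw [IsRoot.def, eval_map_algebraMap] at hy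
    obtain ⟨s, hs, rfl⟩ := hroot y hy
    have hr : p.IsRoot (-s) := by
      have h : aeval ((algebraMap ℝ ℂ) (-s)) p = 0 := by simpa using hy
      rw [aeval_algebraMap_apply] at h
      simpa [coe_aeval_eq_eval] using h
    obtain ⟨q, rfl⟩ := dvd_iff_isRoot.2 hr
    rw [C_neg, sub_neg_eq_add] at *
    have c0 : ((X + C s) * q).coeff 0 = s * q.coeff 0 := by simp [mul_coeff_zero]
    have cs : ∀ d, ((X + C s) * q).coeff (d + 1) = q.coeff d + s * q.coeff (d + 1) := by
      intro d; simp [add_mul]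
    have c1 : ((X + C s) * q).coeff 1 = q.coeff 0 + s * q.coeff 1 := cs 0
    rw [c0] at h0
    have hq0 : 0 < q.coeff 0 := pos_of_mul_pos_right h0 hs.le
    have hqne : q ≠ 0 := by rintro rfl; simp at hq0
    obtain ⟨hnn, hle⟩ := ih q.natDegree (by
      rw [← hN, natDegree_mul (X_add_C_ne_zero s) hqne, natDegree_X_add_C]; omega) q hq0
      (fun y hy => hroot y (by simp [hy])) rfl
    refine ⟨fun d => ?_, fun d => ?_⟩
    · cases d with
      | zero => rw [c0]; exact h0.le
      | succ d => rw [cs]; exact add_nonneg (hnn d) (mul_nonneg hs.le (hnn _))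
    · cases d with
      | zero => exact le_rfl
      | succ d =>
        rw [c0, cs (d + 1), cs d, c1]
        have := mul_le_mul_of_nonneg_left (hle (d + 1)) (mul_pos hs hs).le
        have := mul_nonneg (hnn 0) (hnn d)
        have := mul_nonneg hs.le (mul_nonneg (hnn 1) (hnn d))
        nlinarith

/-- The weight `c²` on the edges of `G`, extended by zero to all pairs. -/
noncomputable def layerWeight {V : Type*} (G : SimpleGraph V) (c : ℝ) (e : Sym2 V) : ℝ :=
  if e ∈ G.edgeSet then c ^ 2 else 0

/-- The weights of the edges of `G □ K₂`, extended by zero to all pairs. -/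
noncomputable def prismWeight {V : Type*} (G : SimpleGraph V) (c : ℝ)
    (e : Sym2 (V × Fin 2)) : ℝ :=
  if e ∈ (G.boxProd (⊤ : SimpleGraph (Fin 2))).edgeSet then
    if (Sym2.map Prod.snd e).IsDiag then c ^ 2 else 1 else 0

lemma matchPoly_prismWeight {V : Type*} [DecidableEq V] [Fintype V] (G : SimpleGraph V) (c : ℝ) :
    matchPoly (prismWeight G c) Finset.univ =
      ∑ S : Finset V, matchPoly (layerWeight G c) S ^ 2 := by
  have hi : ∀ i : Fin 2, i ≠ 1 - i := by decide
  apply matchPoly_prism_univ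
  · intro u v i _
    simp [prismWeight, layerWeight]
  · intro v i
    simp [prismWeight, hi i]
  · intro u v i huv
    simp [prismWeight, hi i, huv]

/-- The generating polynomial `∑ₖ Zₖ y^{n-k}`. -/
noncomputable def zPoly {V : Type*} [Fintype V] (G : SimpleGraph V) (c : ℝ) : ℝ[X] :=
  ∑ k ∈ Finset.range (Fintype.card V + 1), C (Zk G c k) * X ^ (Fintype.card V - k)

lemma coeff_zPoly {V : Type*} [Fintype V] (G : SimpleGraph V) (c : ℝ) {k : ℕ}
    (hk : k ≤ Fintype.card V) : (zPoly G c).coeff (Fintype.card V - k) = Zk G c k := by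
  rw [zPoly, finsetSum_coeff, Finset.sum_eq_single k]
  · simp
  · intro j hj hjk
    rw [coeff_C_mul_X_pow, if_neg]
    have := Finset.mem_range.1 hj
    omega
  · intro h
    exact absurd (Finset.mem_range.2 (by omega)) h

lemma Zk_eq_sum_matchingsOn {V : Type*} [DecidableEq V] [Fintype V] (G : SimpleGraph V) (c : ℝ)
    (k : ℕ) : Zk G c k = ∑ M ∈ (matchingsOn (Finset.univ : Finset (V × Fin 2))).filter
      (fun M => M.card = k), ∏ e ∈ M, prismWeight G c e := by
  have hw : ∀ M : Finset (Sym2 (V × Fin 2)),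
      (∀ e ∈ M, e ∈ (G.boxProd (⊤ : SimpleGraph (Fin 2))).edgeSet) →
      wK2 c M = ∏ e ∈ M, prismWeight G c e := by
    intro M hM
    rw [wK2, pow_mul, Finset.card_filter, ← Finset.prod_pow_eq_pow_sum]
    refine Finset.prod_congr rfl fun e he => ?_
    rw [prismWeight, if_pos (hM e he)]
    split_ifs <;> simp
  rw [Zk, Finset.sum_congr rfl fun M hM => hw M (Finset.mem_filter.1 hM).2.1.1]
  refine Finset.sum_subset (fun M hM => ?_) fun M hM hM' => ?_
  · simp only [Finset.mem_filter, Finset.mem_univ, true_and, mem_matchingsOn] at hM ⊢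
    exact ⟨⟨by simp, fun e he => SimpleGraph.not_isDiag_of_mem_edgeSet _ (hM.1.1 e he), hM.1.2⟩,
      hM.2⟩
  · simp only [Finset.mem_filter, Finset.mem_univ, true_and, mem_matchingsOn] at hM hM'
    have : ∃ e ∈ M, e ∉ (G.boxProd (⊤ : SimpleGraph (Fin 2))).edgeSet := by
      by_contra! h
      exact hM' ⟨⟨h, hM.1.2.2⟩, hM.2⟩
    obtain ⟨e, he, hne⟩ := this
    exact Finset.prod_eq_zero he (by rw [prismWeight, if_neg hne])

lemma expand_zPoly {V : Type*} [DecidableEq V] [Fintype V] (G : SimpleGraph V) (c : ℝ) :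
    expand ℝ 2 (zPoly G c) = matchPoly (prismWeight G c) Finset.univ := by
  have hcard : ∀ M ∈ matchingsOn (Finset.univ : Finset (V × Fin 2)),
      (uncovered Finset.univ M).card + 2 * M.card = 2 * Fintype.card V := by
    intro M hM
    rw [card_uncovered_add hM]
    simp [mul_comm]
  rw [matchPoly, ← Finset.sum_fiberwise_of_maps_to (g := Finset.card)
    (t := Finset.range (Fintype.card V + 1))
    (fun M hM => Finset.mem_range.2 (by have := hcard M hM; omega)), zPoly, map_sum]
  refine Finset.sum_congr rfl fun k _ => ?_
  rw [Zk_eq_sum_matchingsOn, map_sum, Finset.sum_mul, map_sum]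
  refine Finset.sum_congr rfl fun M hM => ?_
  rw [← (Finset.mem_filter.1 hM).2, map_mul, expand_C, map_pow, expand_X, ← pow_mul]
  congr 2
  have := hcard M (Finset.mem_filter.1 hM).1
  omega

/-- For every finite simple graph `G` with `n = |V| ≥ 1`, every `c > 0`, and every
integer `k` with `1 ≤ k ≤ n`, one has `Z_{k-1} ≤ 2n²·Z_k` for the weighted matching
counts of `G □ K₂`. -/
theorem stmt8 {V : Type*} [Fintype V] (G : SimpleGraph V) (hn : 1 ≤ Fintype.card V)
    (c : ℝ) (hc : 0 < c) (k : ℕ) (hk1 : 1 ≤ k) (hk2 : k ≤ Fintype.card V) :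
    Zk G c (k - 1) ≤ 2 * (Fintype.card V : ℝ) ^ 2 * Zk G c k := by
  set w := layerWeight G c
  have hP : expand ℝ 2 (zPoly G c) = ∑ S : Finset V, matchPoly w S ^ 2 :=
    (expand_zPoly G c).trans (matchPoly_prismWeight G c)
  have hco : ∀ d, (zPoly G c).coeff d = (∑ S : Finset V, matchPoly w S ^ 2).coeff (d * 2) := by
    intro d
    rw [← hP, coeff_expand_mul two_pos]
  have hpos : 0 < (zPoly G c).coeff 0 := by
    rw [hco, zero_mul, finsetSum_coeff]
    refine Finset.sum_pos' (fun S _ => ?_) ⟨∅, Finset.mem_univ _, ?_⟩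
    · rw [sq, mul_coeff_zero]
      exact mul_self_nonneg _
    · simp [matchPoly_empty]
  have hroot : ∀ y : ℂ, aeval y (zPoly G c) = 0 → ∃ s : ℝ, 0 < s ∧ y = -(s : ℂ) := by
    intro y hy
    obtain ⟨z, rfl⟩ := IsAlgClosed.exists_pow_nat_eq y two_pos
    have hre : ∀ x : ℂ, x ^ 2 = z ^ 2 → x.re ≤ 0 := by
      intro x hx
      by_contra! hpos
      refine (aeval_matchPoly_ne_zero (w := prismWeight G c) (fun e => ?_) hpos Finset.univ).1 ?_
      · rw [prismWeight]
        split_ifs <;> positivity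
      · rw [← expand_zPoly, expand_aeval, hx, hy]
    have hz : z.re = 0 := le_antisymm (hre z rfl) (by simpa using hre (-z) (neg_sq z))
    have him : z.im ≠ 0 := by
      intro h
      rw [show z = 0 from Complex.ext hz h, sq, mul_zero, aeval_def, eval₂_at_zero] at hy
      exact hpos.ne' (by simpa using hy)
    exact ⟨z.im ^ 2, by positivity, by
      apply Complex.ext <;> simp [sq, hz]⟩
  obtain ⟨hnn, hle⟩ := coeff_succ_mul_coeff_zero_le _ hpos hroot
  have h1 := sum_sq_coeff_two_le w
  have e1 := hco 1
  have e0 := hco 0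
  rw [one_mul] at e1
  rw [zero_mul] at e0
  rw [← e1, ← e0] at h1
  have h2 := hle (Fintype.card V - k)
  rw [← coeff_zPoly G c hk2, ← coeff_zPoly G c (show k - 1 ≤ Fintype.card V by omega),
    show Fintype.card V - (k - 1) = Fintype.card V - k + 1 by omega]
  refine le_of_mul_le_mul_right (h2.trans ?_) hpos
  have := mul_le_mul_of_nonneg_right h1 (hnn (Fintype.card V - k))
  linarith
end
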